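/- For every integer t ≥ 1, every finite simple graph G that does not admit a totally odd immersion of K_t has a set of edges F ⊆ E(G) such that the subgraph of G with edge set F is bipartite and the graph obtained from G by deleting the edges in F does not admit an immersion of K_{98000·t + 4410071}. -/

import Mathlib

open SimpleGraph

/-- An immersion of `H` in `G`: an injection `φ` of the vertices of `H` into `G`
(the branch vertices), together with, for each edge `uv` of `H`, a trail in `G`
from `φ u` to `φ v` (the branch trails), such that the branch trails are
pairwise edge-disjoint.  The trail assigned to the reversed adjacency is the
reversed trail, so there is one branch trail per edge of `H`. -/
structure Immersion {V : Type*} {W : Type*} (G : SimpleGraph V) (H : SimpleGraph W) where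
  φ : W ↪ V
  trail : ∀ ⦃u v : W⦄, H.Adj u v → G.Walk (φ u) (φ v)
  isTrail : ∀ ⦃u v : W⦄ (h : H.Adj u v), (trail h).IsTrail
  symm : ∀ ⦃u v : W⦄ (h : H.Adj u v), trail h.symm = (trail h).reverse
  disjoint : ∀ ⦃u v a b : W⦄ (h₁ : H.Adj u v) (h₂ : H.Adj a b),
      s(u, v) ≠ s(a, b) → List.Disjoint (trail h₁).edges (trail h₂).edges

/-- `G` admits an immersion of `H`. -/
def HasImmersion {V W : Type*} (G : SimpleGraph V) (H : SimpleGraph W) : Prop :=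
  Nonempty (Immersion G H)

/-- `G` admits a totally odd immersion of `H`: every branch trail has odd length. -/
def HasTotallyOddImmersion {V W : Type*} (G : SimpleGraph V) (H : SimpleGraph W) : Prop :=
  ∃ I : Immersion G H, ∀ ⦃u v : W⦄ (h : H.Adj u v), Odd (I.trail h).length

/-- `G` admits a totally even immersion of `H`: every branch trail has even length. -/
def HasTotallyEvenImmersion {V W : Type*} (G : SimpleGraph V) (H : SimpleGraph W) : Prop :=
  ∃ I : Immersion G H, ∀ ⦃u v : W⦄ (h : H.Adj u v), Even (I.trail h).length


/-- number of edges leaving `S`. -/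
noncomputable def cutSize {V : Type*} [Fintype V] (H : SimpleGraph V) (S : Set V) : ℕ := by
  classical exact ∑ p : V × V, if H.Adj p.1 p.2 ∧ p.1 ∈ S ∧ p.2 ∉ S then 1 else 0

/-- total capacity inside `S`. -/
noncomputable def capIn {V : Type*} [Fintype V] (c : V → ℕ) (S : Set V) : ℕ := by
  classical exact ∑ v : V, if v ∈ S then c v else 0

/-- number of tokens in `S`. -/
noncomputable def tokIn {V I : Type*} [Fintype I] (y : I → V) (S : Set V) : ℕ := by
  classical exact ∑ i : I, if y i ∈ S then 1 else 0

lemma capIn_modular {V : Type*} [Fintype V] (c : V → ℕ) (S R : Set V) :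
    capIn c S + capIn c R = capIn c (S ∩ R) + capIn c (S ∪ R) := by
  classical
  unfold capIn
  rw [← Finset.sum_add_distrib, ← Finset.sum_add_distrib]
  refine Finset.sum_congr rfl fun v _ => ?_
  by_cases h1 : v ∈ S <;> by_cases h2 : v ∈ R <;> simp [h1, h2]

lemma tokIn_modular {V I : Type*} [Fintype I] (y : I → V) (S R : Set V) :
    tokIn y S + tokIn y R = tokIn y (S ∩ R) + tokIn y (S ∪ R) := by
  classical
  unfold tokIn
  rw [← Finset.sum_add_distrib, ← Finset.sum_add_distrib]
  refine Finset.sum_congr rfl fun v _ => ?_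
  by_cases h1 : y v ∈ S <;> by_cases h2 : y v ∈ R <;> simp [h1, h2]

lemma cutSize_submodular {V : Type*} [Fintype V] (H : SimpleGraph V) (S R : Set V) :
    cutSize H (S ∩ R) + cutSize H (S ∪ R) ≤ cutSize H S + cutSize H R := by
  classical
  unfold cutSize
  rw [← Finset.sum_add_distrib, ← Finset.sum_add_distrib]
  refine Finset.sum_le_sum fun p _ => ?_
  by_cases h0 : H.Adj p.1 p.2 <;> by_cases h1 : p.1 ∈ S <;> by_cases h2 : p.1 ∈ R <;>
    by_cases h3 : p.2 ∈ S <;> by_cases h4 : p.2 ∈ R <;> simp [h0, h1, h2, h3, h4]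

/-- strict submodularity when an edge joins `S \ R` and `R \ S`. -/
lemma cutSize_submodular_strict {V : Type*} [Fintype V] (H : SimpleGraph V) (S R : Set V)
    {x y : V} (hxy : H.Adj x y) (hxS : x ∈ S) (hyS : y ∉ S) (hyR : y ∈ R) (hxR : x ∉ R) :
    cutSize H (S ∩ R) + cutSize H (S ∪ R) + 2 ≤ cutSize H S + cutSize H R := by
  classical
  have hne : ((x, y) : V × V) ≠ (y, x) := by
    intro h; exact hxy.ne (congrArg Prod.fst h)
  have h2 : (2 : ℕ) = ∑ p : V × V, ((if p = (x, y) then 1 else 0) + (if p = (y, x) then 1 else 0)) := by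
    rw [Finset.sum_add_distrib]; simp
  rw [h2]
  unfold cutSize
  rw [← Finset.sum_add_distrib, ← Finset.sum_add_distrib, ← Finset.sum_add_distrib]
  refine Finset.sum_le_sum fun p _ => ?_
  by_cases hp1 : p = (x, y)
  · subst hp1; simp [hxy, hxS, hyS, hyR, hxR, hne]
  by_cases hp2 : p = (y, x)
  · subst hp2; simp [hxy.symm, hxS, hyS, hyR, hxR, hne.symm]
  simp only [hp1, hp2, if_false, add_zero]
  by_cases h0 : H.Adj p.1 p.2 <;> by_cases h1 : p.1 ∈ S <;> by_cases h2 : p.1 ∈ R <;>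
    by_cases h3 : p.2 ∈ S <;> by_cases h4 : p.2 ∈ R <;> simp [h0, h1, h2, h3, h4]

lemma cutSize_delete_le {V : Type*} [Fintype V] (H : SimpleGraph V) (S : Set V) (x y : V) :
    cutSize H S ≤ cutSize (H.deleteEdges {s(x, y)}) S + 1 := by
  classical
  by_cases hx : x ∈ S ∧ y ∉ S
  · have h1 : (1 : ℕ) = ∑ p : V × V, (if p = (x, y) then 1 else 0) := by simp
    rw [h1]; unfold cutSize
    rw [← Finset.sum_add_distrib]
    refine Finset.sum_le_sum fun p _ => ?_
    obtain ⟨a, b⟩ := p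
    by_cases hp : a = x ∧ b = y
    · obtain ⟨rfl, rfl⟩ := hp; simp; split_ifs <;> simp
    · split_ifs <;> grind [deleteEdges_adj]
  · have h1 : (1 : ℕ) = ∑ p : V × V, (if p = (y, x) then 1 else 0) := by simp
    rw [h1]; unfold cutSize
    rw [← Finset.sum_add_distrib]
    refine Finset.sum_le_sum fun p _ => ?_
    obtain ⟨a, b⟩ := p
    by_cases hp : a = y ∧ b = x
    · obtain ⟨rfl, rfl⟩ := hp; simp; split_ifs <;> simp
    · split_ifs <;> grind [deleteEdges_adj]

lemma cutSize_delete_eq {V : Type*} [Fintype V] (H : SimpleGraph V) (S : Set V) (x y : V)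
    (h : x ∈ S ↔ y ∈ S) :
    cutSize H S = cutSize (H.deleteEdges {s(x, y)}) S := by
  classical
  unfold cutSize
  refine Finset.sum_congr rfl fun p _ => ?_
  obtain ⟨a, b⟩ := p
  split_ifs <;> grind [deleteEdges_adj]

lemma cutSize_empty {V : Type*} [Fintype V] (H : SimpleGraph V) (S : Set V)
    (h : ∀ x y, H.Adj x y → x ∈ S → y ∈ S) : cutSize H S = 0 := by
  classical
  unfold cutSize
  refine Finset.sum_eq_zero fun p _ => ?_
  rw [if_neg]; rintro ⟨h1, h2, h3⟩; exact h3 (h _ _ h1 h2)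

lemma tokIn_update {V I : Type*} [Fintype I] [DecidableEq I] (y : I → V) (S : Set V) (i : I) (v : V) :
    (v ∉ S → y i ∈ S → tokIn (Function.update y i v) S + 1 = tokIn y S) ∧
    (v ∈ S → y i ∉ S → tokIn (Function.update y i v) S = tokIn y S + 1) ∧
    ((v ∈ S ↔ y i ∈ S) → tokIn (Function.update y i v) S = tokIn y S) := by
  classical
  unfold tokIn
  rw [← Finset.add_sum_erase _ _ (Finset.mem_univ i),
    ← Finset.add_sum_erase _ (fun i => if y i ∈ S then 1 else 0) (Finset.mem_univ i)]
  have : ∑ j ∈ Finset.univ.erase i, (if Function.update y i v j ∈ S then 1 else 0)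
      = ∑ j ∈ Finset.univ.erase i, (if y j ∈ S then 1 else 0) := by
    refine Finset.sum_congr rfl fun j hj => ?_
    rw [Function.update_of_ne (Finset.ne_of_mem_erase hj)]
  rw [this, Function.update_self]
  refine ⟨fun h1 h2 => ?_, fun h1 h2 => ?_, fun h => ?_⟩
  · simp [h1, h2]; omega
  · simp [h1, h2]; omega
  · simp [h]

/-- The result of routing the tokens. -/
def Routable {V I : Type*} [Fintype I] (H : SimpleGraph V) (c : V → ℕ) (y : I → V) : Prop :=
  ∃ (κ : I → V) (w : ∀ i, H.Walk (y i) (κ i)), (∀ i, (w i).IsTrail) ∧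
    (∀ i j, i ≠ j → List.Disjoint (w i).edges (w j).edges) ∧
    ∀ v, tokIn κ {v} ≤ c v

lemma Routable.mono {V I : Type*} [Fintype I] {H H' : SimpleGraph V} {c : V → ℕ} {y : I → V}
    (h : Routable H c y) (hle : H ≤ H') : Routable H' c y := by
  obtain ⟨κ, w, h1, h2, h3⟩ := h
  refine ⟨κ, fun i => (w i).mapLe hle, fun i => (h1 i).mapLe hle, fun i j hij => ?_, h3⟩
  simpa [Walk.edges_mapLe_eq_edges] using h2 i j hij

lemma Routable.step {V I : Type*} [Fintype I] [DecidableEq I] {H : SimpleGraph V} {c : V → ℕ} {y : I → V}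
    {x z : V} (hxz : H.Adj x z) (i : I) (hi : y i = x)
    (h : Routable (H.deleteEdges {s(x, z)}) c (Function.update y i z)) : Routable H c y := by
  obtain ⟨κ, w, h1, h2, h3⟩ := h
  have hle : H.deleteEdges {s(x, z)} ≤ H := deleteEdges_le _
  have key : ∀ j, ∃ w' : H.Walk (y j) (κ j), w'.IsTrail ∧
      ∀ e ∈ w'.edges, e ∈ (w j).edges ∨ (j = i ∧ e = s(x, z)) := by
    intro j
    by_cases hj : j = i
    · subst hj
      have hw : ∀ e ∈ (w j).edges, e ≠ s(x, z) := by
        intro e he h'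
        have := Walk.edges_subset_edgeSet _ he
        rw [edgeSet_deleteEdges] at this
        exact this.2 h'
      have hu : Function.update y j z j = z := Function.update_self ..
      let w1 : H.Walk z (κ j) := ((w j).mapLe hle).copy hu rfl
      have e1 : w1.edges = (w j).edges := by simp [w1]
      have t1 : w1.IsTrail := by
        rw [Walk.isTrail_def, e1]; exact (h1 j).edges_nodup
      subst hi
      refine ⟨Walk.cons hxz w1, ?_, ?_⟩
      · rw [Walk.isTrail_cons]; exact ⟨t1, by rw [e1]; exact fun h => hw _ h rfl⟩
      · intro e he
        simp only [Walk.edges_cons, List.mem_cons, e1] at he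
        tauto
    · have hu : Function.update y i z j = y j := Function.update_of_ne hj ..
      let w1 : H.Walk (y j) (κ j) := ((w j).mapLe hle).copy hu rfl
      have e1 : w1.edges = (w j).edges := by simp [w1]
      refine ⟨w1, ?_, ?_⟩
      · rw [Walk.isTrail_def, e1]; exact (h1 j).edges_nodup
      · intro e he; rw [e1] at he; exact Or.inl he
  choose w' hw1 hw2 using key
  have hnot : ∀ j, s(x, z) ∉ (w j).edges := by
    intro j he
    have := Walk.edges_subset_edgeSet _ he
    rw [edgeSet_deleteEdges] at this
    exact this.2 rfl
  refine ⟨κ, w', hw1, fun j k hjk e hj hk => ?_, h3⟩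
  rcases hw2 j e hj with h | ⟨h, h'⟩ <;> rcases hw2 k e hk with g | ⟨g, g'⟩
  · exact h2 j k hjk h g
  · subst g'; exact hnot _ h
  · subst h'; exact hnot _ g
  · exact hjk (h.trans g.symm)

lemma cutSize_diff_singleton {V : Type*} [Fintype V] (H : SimpleGraph V) (S : Set V) {x z : V}
    (hx : x ∈ S) (hz : z ∉ S) (hxz : H.Adj x z) (hn : ∀ u ∈ S, ¬ H.Adj x u) :
    cutSize H (S \ {x}) + 1 ≤ cutSize H S := by
  classical
  have h1 : (1 : ℕ) = ∑ p : V × V, (if p = (x, z) then 1 else 0) := by simp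
  rw [h1]; unfold cutSize
  rw [← Finset.sum_add_distrib]
  refine Finset.sum_le_sum fun p _ => ?_
  obtain ⟨a, b⟩ := p
  by_cases hp : a = x ∧ b = z
  · obtain ⟨rfl, rfl⟩ := hp; simp [hxz, hx, hz]
  · have := fun h => hn a h
    split_ifs <;> grind [SimpleGraph.adj_comm]

theorem menger {V I : Type*} [Fintype V] [Fintype I] (c : V → ℕ) :
    ∀ (n : ℕ) (H : SimpleGraph V) (y : I → V), H.edgeSet.ncard = n →
      (∀ S : Set V, tokIn y S ≤ cutSize H S + capIn c S) → Routable H c y := by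
  classical
  intro n
  induction n with
  | zero =>
    intro H y hn hcut
    have hE : H.edgeSet = ∅ := (Set.ncard_eq_zero (Set.toFinite _)).1 hn
    refine ⟨y, fun i => Walk.nil, fun i => Walk.IsTrail.nil, fun i j _ => by simp, fun v => ?_⟩
    refine (hcut {v}).trans ?_
    rw [cutSize_empty]
    · simp [capIn]
    · intro a b hab
      have : s(a, b) ∈ H.edgeSet := hab
      rw [hE] at this; exact this.elim
  | succ n ih =>
    intro H y hn hcut
    have hdel : ∀ x z, H.Adj x z → (H.deleteEdges {s(x, z)}).edgeSet.ncard = n := by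
      intro x z hxz
      have hm : s(x, z) ∈ H.edgeSet := hxz
      rw [edgeSet_deleteEdges, Set.ncard_sdiff_singleton_of_mem hm, hn]; rfl
    by_cases hA : ∃ x z, H.Adj x z ∧ ∀ S : Set V, ((x ∈ S ∧ z ∉ S) ∨ (z ∈ S ∧ x ∉ S)) →
        tokIn y S ≠ cutSize H S + capIn c S
    · obtain ⟨x, z, hxz, hS⟩ := hA
      refine (ih _ y (hdel x z hxz) fun S => ?_).mono (deleteEdges_le _)
      have h1 := hcut S
      by_cases hs : x ∈ S ↔ z ∈ S
      · rwa [← cutSize_delete_eq H S x z hs]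
      · have h2 := cutSize_delete_le H S x z
        have h3 := hS S (by tauto)
        omega
    push Not at hA
    let P : Set (Set V) := {S | tokIn y S = cutSize H S + capIn c S ∧
      ∃ x z, H.Adj x z ∧ x ∈ S ∧ z ∉ S}
    have hP : P.Nonempty := by
      have hne : H.edgeSet.Nonempty := by
        rw [← Set.ncard_pos (Set.toFinite _)]; omega
      obtain ⟨e, he⟩ := hne
      induction e with
      | _ x z =>
        obtain ⟨S, hS, ht⟩ := hA x z he
        rcases hS with hS | hS
        · exact ⟨S, ht, x, z, he, hS.1, hS.2⟩
        · exact ⟨S, ht, z, x, (show H.Adj x z from he).symm, hS.1, hS.2⟩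
    obtain ⟨S, hSmin⟩ := (Set.toFinite P).exists_minimal hP
    obtain ⟨hSt, x, z, hxz, hx, hz⟩ := hSmin.prop
    have hmin : ∀ R ∈ P, R ⊆ S → R = S := fun R hR hRS =>
      Set.Subset.antisymm hRS (hSmin.le_of_le hR hRS)
    have htight : ∀ R : Set V, tokIn y R = cutSize H R + capIn c R →
        tokIn y (S ∩ R) = cutSize H (S ∩ R) + capIn c (S ∩ R) := by
      intro R hR
      have h1 := tokIn_modular y S R
      have h2 := capIn_modular c S R
      have h3 := cutSize_submodular H S R
      have h4 := hcut (S ∩ R)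
      have h5 := hcut (S ∪ R)
      omega
    have hn : ∀ u ∈ S, ¬ H.Adj x u := by
      intro u hu hxu
      obtain ⟨R, hR, ht⟩ := hA x u hxu
      have ht' := htight R ht
      rcases hR with hR | hR
      · have := hmin (S ∩ R) ⟨ht', x, u, hxu, ⟨hx, hR.1⟩, fun h => hR.2 h.2⟩ Set.inter_subset_left
        rw [← this] at hu; exact hR.2 hu.2
      · have := hmin (S ∩ R) ⟨ht', u, x, hxu.symm, ⟨hu, hR.1⟩, fun h => hR.2 h.2⟩
          Set.inter_subset_left
        rw [← this] at hx; exact hR.2 hx.2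
    have htok : ∃ i, y i = x := by
      by_contra hno
      push Not at hno
      have h1 := hcut (S \ {x})
      have h2 := cutSize_diff_singleton H S hx hz hxz hn
      have h3 : tokIn y (S \ {x}) = tokIn y S := by
        unfold tokIn
        refine Finset.sum_congr rfl fun i _ => ?_
        simp [hno i]
      have h4 : capIn c (S \ {x}) ≤ capIn c S := by
        unfold capIn
        refine Finset.sum_le_sum fun v _ => ?_
        by_cases hv : v ∈ S <;> by_cases hv' : v = x <;> simp [hv, hv']
      omega
    obtain ⟨i, hi⟩ := htok
    refine Routable.step hxz i hi (ih _ _ (hdel x z hxz) fun R => ?_)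
    obtain ⟨u1, u2, u3⟩ := tokIn_update y R i z
    rw [hi] at u1 u2 u3
    have h1 := hcut R
    have h2 := cutSize_delete_le H R x z
    by_cases hxR : x ∈ R <;> by_cases hzR : z ∈ R
    · rw [← cutSize_delete_eq H R x z (by tauto)]; have := u3 (by tauto); omega
    · have := u1 hzR hxR; omega
    · have := u2 hzR hxR
      have k1 := tokIn_modular y S R
      have k2 := capIn_modular c S R
      have k3 := cutSize_submodular_strict H S R hxz hx hz hzR hxR
      have k4 := hcut (S ∩ R)
      have k5 := hcut (S ∪ R)
      omega
    · rw [← cutSize_delete_eq H R x z (by tauto)]; have := u3 (by tauto); omega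

/-- `x` and `y` agree on many elements of `M`. -/
def GoodPair {U : Type*} (χ : U → U → Bool) (M : Finset U) (t : ℕ) (x y : U) : Prop :=
  10 * t ≤ (M.filter fun m => χ x m = χ y m).card

lemma exists_notMem_of_card {U : Type*} [DecidableEq U] (A B : Finset U) (h : B.card < A.card) :
    ∃ x ∈ A, x ∉ B := by
  by_contra hc
  push Not at hc
  exact absurd (Finset.card_le_card hc) (by omega)

theorem greedy_route {U E : Type*} [DecidableEq U] [Fintype E] [DecidableEq E]
    (κ β : E → U) (t : ℕ) (ht : 1 ≤ t)
    (hκ : ∀ k, (Finset.univ.filter fun e => κ e = k).card ≤ t)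
    (hβ : ∀ k, (Finset.univ.filter fun e => β e = k).card ≤ t)
    (hE : Fintype.card E ≤ t * t) (M L : Finset U) (χ : U → U → Bool)
    (hL : ∀ e, ∃ A ⊆ L, t ≤ A.card ∧ ∀ x ∈ A, GoodPair χ M t (κ e) x ∧ GoodPair χ M t x (β e)) :
    ∃ m l m' : E → U, (∀ e, m e ∈ M ∧ l e ∈ L ∧ m' e ∈ M ∧ χ (κ e) (m e) = χ (l e) (m e) ∧
      χ (l e) (m' e) = χ (β e) (m' e) ∧ m e ≠ m' e) ∧
      ∀ e f, e ≠ f → (κ e = κ f → m e ≠ m f) ∧ (β e = β f → m' e ≠ m' f) ∧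
        (l e = l f → m e ≠ m f ∧ m e ≠ m' f ∧ m' e ≠ m f ∧ m' e ≠ m' f) := by
  suffices H : ∀ s : Finset E, ∃ m l m' : E → U,
      (∀ e ∈ s, m e ∈ M ∧ l e ∈ L ∧ m' e ∈ M ∧ χ (κ e) (m e) = χ (l e) (m e) ∧
      χ (l e) (m' e) = χ (β e) (m' e) ∧ m e ≠ m' e) ∧
      (∀ e ∈ s, ∀ f ∈ s, e ≠ f → (κ e = κ f → m e ≠ m f) ∧ (β e = β f → m' e ≠ m' f) ∧
        (l e = l f → m e ≠ m f ∧ m e ≠ m' f ∧ m' e ≠ m f ∧ m' e ≠ m' f)) ∧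
      ∀ x, (s.filter fun e => l e = x).card ≤ t by
    obtain ⟨m, l, m', h1, h2, -⟩ := H Finset.univ
    exact ⟨m, l, m', fun e => h1 e (Finset.mem_univ _),
      fun e f => h2 e (Finset.mem_univ _) f (Finset.mem_univ _)⟩
  intro s
  induction s using Finset.induction_on with
  | empty =>
    by_cases hE' : Nonempty E
    · obtain ⟨e⟩ := hE'
      exact ⟨fun _ => κ e, fun _ => κ e, fun _ => κ e, by simp, by simp, by simp⟩
    · exact ⟨fun e => (hE' ⟨e⟩).elim, fun e => (hE' ⟨e⟩).elim, fun e => (hE' ⟨e⟩).elim,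
        by simp, by simp, by simp⟩
  | insert e₀ s he₀ ih =>
    obtain ⟨m, l, m', h1, h2, h3⟩ := ih
    obtain ⟨A, hAL, hAc, hA⟩ := hL e₀
    -- choose `x`
    have hx : ∃ x ∈ A, (s.filter fun e => l e = x).card < t := by
      by_contra hc
      push Not at hc
      have k1 : A.card * t ≤ ∑ x ∈ A, (s.filter fun e => l e = x).card := by
        simpa using Finset.card_nsmul_le_sum A _ t hc
      have k2 : ∑ x ∈ A, (s.filter fun e => l e = x).card ≤ s.card := by
        rw [← Finset.card_biUnion]
        · apply Finset.card_le_card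
          intro e he
          simp only [Finset.mem_biUnion, Finset.mem_filter] at he
          obtain ⟨_, _, h, _⟩ := he; exact h
        · intro a _ b _ hab
          rw [Function.onFun, Finset.disjoint_left]
          intro e he he'
          simp only [Finset.mem_filter] at he he'
          exact hab (he.2.symm.trans he'.2)
      have k3 : s.card < t * t := by
        refine lt_of_lt_of_le ?_ hE
        exact Finset.card_lt_univ_of_notMem he₀
      have k4 : t * t ≤ A.card * t := Nat.mul_le_mul_right _ hAc
      omega
    obtain ⟨x, hxA, hxl⟩ := hx
    obtain ⟨g1, g2⟩ := hA x hxA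
    have hκs : (s.filter fun e => κ e = κ e₀).card ≤ t :=
      (Finset.card_le_card (Finset.filter_subset_filter _ (Finset.subset_univ s))).trans (hκ _)
    have hβs : (s.filter fun e => β e = β e₀).card ≤ t :=
      (Finset.card_le_card (Finset.filter_subset_filter _ (Finset.subset_univ s))).trans (hβ _)
    let B0 := (s.filter fun e => l e = x).image m ∪ (s.filter fun e => l e = x).image m'
    have hB0 : B0.card ≤ 2 * t := by
      refine (Finset.card_union_le _ _).trans ?_
      have := Finset.card_image_le (s := s.filter fun e => l e = x) (f := m)
      have := Finset.card_image_le (s := s.filter fun e => l e = x) (f := m')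
      omega
    obtain ⟨p, hpM, hpB⟩ := exists_notMem_of_card (M.filter fun m => χ (κ e₀) m = χ x m)
      ((s.filter fun e => κ e = κ e₀).image m ∪ B0) (by
        refine lt_of_le_of_lt (Finset.card_union_le _ _) (lt_of_lt_of_le ?_ g1)
        have := Finset.card_image_le (s := s.filter fun e => κ e = κ e₀) (f := m)
        omega)
    obtain ⟨q, hqM, hqB⟩ := exists_notMem_of_card (M.filter fun m => χ x m = χ (β e₀) m)
      ((s.filter fun e => β e = β e₀).image m' ∪ (B0 ∪ {p})) (by
        refine lt_of_le_of_lt (Finset.card_union_le _ _) (lt_of_lt_of_le ?_ g2)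
        have := Finset.card_image_le (s := s.filter fun e => β e = β e₀) (f := m')
        have := Finset.card_union_le B0 {p}
        rw [Finset.card_singleton] at this
        omega)
    simp only [B0, Finset.mem_union, Finset.mem_image, Finset.mem_filter, not_or, not_exists,
      not_and, Finset.mem_singleton] at hpM hpB hqM hqB
    obtain ⟨p1, p2, p3⟩ := hpB
    obtain ⟨q1, ⟨q2, q3⟩, q4⟩ := hqB
    have hne : ∀ e ∈ s, e ≠ e₀ := fun e he h => he₀ (h ▸ he)
    refine ⟨Function.update m e₀ p, Function.update l e₀ x, Function.update m' e₀ q, ?_, ?_, ?_⟩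
    · intro e he
      rcases Finset.mem_insert.1 he with rfl | he
      · simp only [Function.update_self]
        exact ⟨hpM.1, hAL hxA, hqM.1, hpM.2, hqM.2, fun h => q4 h.symm⟩
      · simp only [Function.update_of_ne (hne e he)]
        exact h1 e he
    · intro e he f hf hef
      rcases Finset.mem_insert.1 he with rfl | he1 <;> rcases Finset.mem_insert.1 hf with rfl | hf1
      · exact (hef rfl).elim
      · simp only [Function.update_self, Function.update_of_ne (hne f hf1)]
        refine ⟨fun h h' => p1 f ⟨hf1, h.symm⟩ h'.symm, fun h h' => q1 f ⟨hf1, h.symm⟩ h'.symm, fun h =>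
          ⟨fun h' => p2 f ⟨hf1, h.symm⟩ h'.symm, fun h' => p3 f ⟨hf1, h.symm⟩ h'.symm,
          fun h' => q2 f ⟨hf1, h.symm⟩ h'.symm, fun h' => q3 f ⟨hf1, h.symm⟩ h'.symm⟩⟩
      · simp only [Function.update_self, Function.update_of_ne (hne e he1)]
        refine ⟨fun h h' => p1 e ⟨he1, h⟩ h', fun h h' => q1 e ⟨he1, h⟩ h', fun h =>
          ⟨fun h' => p2 e ⟨he1, h⟩ h', fun h' => q2 e ⟨he1, h⟩ h',
          fun h' => p3 e ⟨he1, h⟩ h', fun h' => q3 e ⟨he1, h⟩ h'⟩⟩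
      · simp only [Function.update_of_ne (hne e he1), Function.update_of_ne (hne f hf1)]
        exact h2 e he1 f hf1 hef
    · intro u
      have hs : (s.filter fun e => Function.update l e₀ x e = u) = s.filter fun e => l e = u := by
        apply Finset.filter_congr
        intro e he
        rw [Function.update_of_ne (hne e he)]
      rw [Finset.filter_insert, hs, Function.update_self]
      split_ifs with hxu
      · subst hxu
        exact (Finset.card_insert_le _ _).trans hxl
      · exact h3 u

/-- Selection of the vertex classes. -/
theorem select_classes {U : Type*} [Fintype U] [DecidableEq U] (t : ℕ)
    (hU : 60 * t ≤ Fintype.card U) (χ : U → U → Bool) :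
    ∃ T K L M : Finset U, T.card = t ∧ K.card = t ∧ Disjoint T K ∧ Disjoint T L ∧ Disjoint T M ∧
      Disjoint K L ∧ Disjoint K M ∧ Disjoint L M ∧
      ∀ k ∈ K, ∀ b ∈ T, ∃ A ⊆ L, t ≤ A.card ∧
        ∀ x ∈ A, GoodPair χ M t k x ∧ GoodPair χ M t x b := by
  classical
  obtain ⟨M, -, hM⟩ := Finset.exists_subset_card_eq (s := (Finset.univ : Finset U)) (n := 30 * t)
    (by rw [Finset.card_univ]; omega)
  let W : Finset U := Finset.univ \ M
  have hW : 30 * t ≤ W.card := by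
    have := Finset.card_sdiff_of_subset (Finset.subset_univ M)
    rw [Finset.card_univ, hM] at this
    simp only [W]; omega
  have hWM : Disjoint W M := Finset.sdiff_disjoint
  have hsymm : ∀ x y, GoodPair χ M t x y → GoodPair χ M t y x := by
    intro x y h
    unfold GoodPair at *
    simpa only [eq_comm] using h
  by_cases hbad : ∃ v, 3 * t ≤ (W.filter fun x => ¬ GoodPair χ M t v x).card
  · obtain ⟨v, hv⟩ := hbad
    have hgood : ∀ x y, ¬ GoodPair χ M t v x → ¬ GoodPair χ M t v y → GoodPair χ M t x y := by
      intro x y hx hy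
      unfold GoodPair at *
      have hsub : M ⊆ (M.filter fun m => χ v m = χ x m) ∪ ((M.filter fun m => χ v m = χ y m) ∪
          (M.filter fun m => χ x m = χ y m)) := by
        intro m hm
        simp only [Finset.mem_union, Finset.mem_filter, hm, true_and]
        cases χ v m <;> cases χ x m <;> cases χ y m <;> simp
      have c1 := Finset.card_le_card hsub
      have c2 := Finset.card_union_le (M.filter fun m => χ v m = χ x m)
        ((M.filter fun m => χ v m = χ y m) ∪ (M.filter fun m => χ x m = χ y m))
      have c3 := Finset.card_union_le (M.filter fun m => χ v m = χ y m)
        (M.filter fun m => χ x m = χ y m)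
      omega
    set C := W.filter fun x => ¬ GoodPair χ M t v x with hC
    have hCW : C ⊆ W := Finset.filter_subset _ _
    obtain ⟨T, hTC, hT⟩ := Finset.exists_subset_card_eq (s := C) (n := t) (by omega)
    obtain ⟨K, hKC, hK⟩ := Finset.exists_subset_card_eq (s := C \ T) (n := t)
      (by rw [Finset.card_sdiff_of_subset hTC]; omega)
    have hKC' : K ⊆ C := hKC.trans Finset.sdiff_subset
    have hTK : Disjoint T K := (Finset.disjoint_of_subset_left hKC Finset.sdiff_disjoint).symm
    have hL : t ≤ (C \ (T ∪ K)).card := by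
      rw [Finset.card_sdiff_of_subset (Finset.union_subset hTC hKC')]
      have := Finset.card_union_le T K
      omega
    have hd : Disjoint (C \ (T ∪ K)) (T ∪ K) := Finset.sdiff_disjoint
    rw [Finset.disjoint_union_right] at hd
    have hCM := Finset.disjoint_of_subset_left hCW hWM
    refine ⟨T, K, C \ (T ∪ K), M, hT, hK, hTK, hd.1.symm, Finset.disjoint_of_subset_left hTC hCM,
      hd.2.symm, Finset.disjoint_of_subset_left hKC' hCM,
      Finset.disjoint_of_subset_left Finset.sdiff_subset hCM, ?_⟩
    intro k hk b hb
    refine ⟨_, Finset.Subset.refl _, hL, fun x hx => ?_⟩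
    have hx' := (Finset.mem_filter.1 (Finset.mem_sdiff.1 hx).1).2
    exact ⟨hgood _ _ (Finset.mem_filter.1 (hKC' hk)).2 hx',
      hgood _ _ hx' (Finset.mem_filter.1 (hTC hb)).2⟩
  · push Not at hbad
    obtain ⟨T, hTC, hT⟩ := Finset.exists_subset_card_eq (s := W) (n := t) (by omega)
    obtain ⟨K, hKC, hK⟩ := Finset.exists_subset_card_eq (s := W \ T) (n := t)
      (by rw [Finset.card_sdiff_of_subset hTC]; omega)
    have hKC' : K ⊆ W := hKC.trans Finset.sdiff_subset
    have hTK : Disjoint T K := (Finset.disjoint_of_subset_left hKC Finset.sdiff_disjoint).symm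
    have hL : 28 * t ≤ (W \ (T ∪ K)).card := by
      rw [Finset.card_sdiff_of_subset (Finset.union_subset hTC hKC')]
      have := Finset.card_union_le T K
      omega
    have hd : Disjoint (W \ (T ∪ K)) (T ∪ K) := Finset.sdiff_disjoint
    rw [Finset.disjoint_union_right] at hd
    refine ⟨T, K, W \ (T ∪ K), M, hT, hK, hTK, hd.1.symm, Finset.disjoint_of_subset_left hTC hWM,
      hd.2.symm, Finset.disjoint_of_subset_left hKC' hWM,
      Finset.disjoint_of_subset_left Finset.sdiff_subset hWM, ?_⟩
    intro k hk b hb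
    refine ⟨(W \ (T ∪ K)) \ ((W.filter fun x => ¬ GoodPair χ M t k x) ∪
      (W.filter fun x => ¬ GoodPair χ M t b x)), Finset.sdiff_subset, ?_, ?_⟩
    · have c1 := Finset.le_card_sdiff ((W.filter fun x => ¬ GoodPair χ M t k x) ∪
        (W.filter fun x => ¬ GoodPair χ M t b x)) (W \ (T ∪ K))
      have c2 := Finset.card_union_le (W.filter fun x => ¬ GoodPair χ M t k x)
        (W.filter fun x => ¬ GoodPair χ M t b x)
      have c3 := hbad k
      have c4 := hbad b
      omega
    · intro x hx
      rw [Finset.mem_sdiff, Finset.mem_union, not_or] at hx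
      have hxW := (Finset.mem_sdiff.1 hx.1).1
      simp only [Finset.mem_filter, hxW, true_and, not_not] at hx
      exact ⟨hx.2.1, hsymm _ _ hx.2.2⟩

/-- The edges of `G` that are bichromatic under `col`. -/
def biG {V : Type*} (G : SimpleGraph V) (col : V → Bool) : SimpleGraph V :=
  G ⊓ (⊤ : SimpleGraph Bool).comap col

lemma biG_adj {V : Type*} (G : SimpleGraph V) (col : V → Bool) (x y : V) :
    (biG G col).Adj x y ↔ G.Adj x y ∧ col x ≠ col y := by
  simp [biG]

lemma mono_adj {V : Type*} (G : SimpleGraph V) (col : V → Bool) (x y : V) :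
    (G.deleteEdges (biG G col).edgeSet).Adj x y ↔ G.Adj x y ∧ col x = col y := by
  rw [deleteEdges_adj, mem_edgeSet, biG_adj]
  tauto

lemma cutSize_swap {V : Type*} [Fintype V] [DecidableEq V] (H : SimpleGraph V) (S : Set V)
    [∀ p : V × V, Decidable (H.Adj p.1 p.2 ∧ p.2 ∈ S ∧ p.1 ∉ S)] :
    cutSize H S = ∑ p : V × V, if H.Adj p.1 p.2 ∧ p.2 ∈ S ∧ p.1 ∉ S then 1 else 0 := by
  classical
  unfold cutSize
  rw [← Equiv.sum_comp (Equiv.prodComm V V)]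
  refine Finset.sum_congr rfl fun p _ => ?_
  simp [SimpleGraph.adj_comm]

/-- A maximum cut dominates its complement in every cut. -/
lemma exists_max_cut {V : Type*} [Fintype V] (G : SimpleGraph V) :
    ∃ col : V → Bool, ∀ S : Set V,
      cutSize (G.deleteEdges (biG G col).edgeSet) S ≤ cutSize (biG G col) S := by
  classical
  obtain ⟨col, hcol⟩ := Finite.exists_max (fun col : V → Bool =>
    ∑ p : V × V, if G.Adj p.1 p.2 ∧ col p.1 ≠ col p.2 then 1 else 0)
  refine ⟨col, fun S => ?_⟩
  have h := hcol (fun x => if x ∈ S then !col x else col x)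
  have key : (∑ p : V × V, if G.Adj p.1 p.2 ∧ (if p.1 ∈ S then !col p.1 else col p.1) ≠
        (if p.2 ∈ S then !col p.2 else col p.2) then 1 else 0) +
      (cutSize (biG G col) S + cutSize (biG G col) S) =
      (∑ p : V × V, if G.Adj p.1 p.2 ∧ col p.1 ≠ col p.2 then 1 else 0) +
      (cutSize (G.deleteEdges (biG G col).edgeSet) S +
        cutSize (G.deleteEdges (biG G col).edgeSet) S) := by
    nth_rewrite 2 [cutSize_swap (biG G col)]
    nth_rewrite 2 [cutSize_swap (G.deleteEdges (biG G col).edgeSet)]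
    unfold cutSize
    simp only [← Finset.sum_add_distrib]
    refine Finset.sum_congr rfl fun p _ => ?_
    simp only [mono_adj, biG_adj]
    by_cases h0 : G.Adj p.1 p.2 <;> by_cases h1 : p.1 ∈ S <;> by_cases h2 : p.2 ∈ S <;>
      cases col p.1 <;> cases col p.2 <;> simp [h0, h1, h2]
  omega

lemma immersion_edge_unique {V U : Type*} {E : SimpleGraph V}
    (I : Immersion E (⊤ : SimpleGraph U)) {i j k l : U} (h : (⊤ : SimpleGraph U).Adj i j)
    (h' : (⊤ : SimpleGraph U).Adj k l) {e : Sym2 V} (he : e ∈ (I.trail h).edges)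
    (he' : e ∈ (I.trail h').edges) : s(i, j) = s(k, l) := by
  by_contra hne
  exact I.disjoint h h' hne he he'

lemma cut_lower {V U : Type*} [Fintype V] {E : SimpleGraph V}
    (I : Immersion E (⊤ : SimpleGraph U)) (S : Set V) (Y : Finset (Sym2 U))
    (hY : ∀ p ∈ Y, ∃ (i j : U) (h : (⊤ : SimpleGraph U).Adj i j), p = s(i, j) ∧
      ∃ x z, x ∈ S ∧ z ∉ S ∧ s(x, z) ∈ (I.trail h).edges) : Y.card ≤ cutSize E S := by
  classical
  rcases Y.eq_empty_or_nonempty with rfl | ⟨p₀, hp₀⟩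
  · simp
  have hV : Nonempty V := by
    obtain ⟨_, _, _, _, x, _⟩ := hY p₀ hp₀
    exact ⟨x⟩
  have key : ∀ p ∈ Y, ∃ q : V × V, q.1 ∈ S ∧ q.2 ∉ S ∧
      ∃ (i j : U) (h : (⊤ : SimpleGraph U).Adj i j), p = s(i, j) ∧
        s(q.1, q.2) ∈ (I.trail h).edges := by
    intro p hp
    obtain ⟨i, j, h, hpe, x, z, hx, hz, he⟩ := hY p hp
    exact ⟨(x, z), hx, hz, i, j, h, hpe, he⟩
  choose! q hq1 hq2 hq3 using key
  unfold cutSize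
  rw [Finset.sum_boole, Nat.cast_id]
  refine Finset.card_le_card_of_injOn q ?_ ?_
  · intro p hpY
    simp only [Finset.coe_filter, Finset.mem_univ, true_and, Set.mem_ofPred_eq]
    obtain ⟨i, j, h, _, he⟩ := hq3 p hpY
    exact ⟨Walk.edges_subset_edgeSet _ he, hq1 p hpY, hq2 p hpY⟩
  · intro p hpY p' hpY' hpq
    obtain ⟨i, j, h, hp, he⟩ := hq3 p hpY
    obtain ⟨i', j', h', hp', he'⟩ := hq3 p' hpY'
    rw [hpq] at he
    rw [hp, hp']
    exact immersion_edge_unique I _ _ he he'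

lemma walk_cross {V : Type*} {E : SimpleGraph V} {u v y : V} (P : E.Walk u v) (S : Set V)
    (hy : y ∈ P.support) (hyS : y ∈ S) (h : ¬ (u ∈ S ∧ v ∈ S)) :
    ∃ x z, x ∈ S ∧ z ∉ S ∧ s(x, z) ∈ P.edges := by
  classical
  by_cases hv : v ∈ S
  · have hu : u ∉ S := fun hu => h ⟨hu, hv⟩
    obtain ⟨d, hd, h1, h2⟩ := (P.takeUntil y hy).reverse.exists_boundary_dart S hyS hu
    refine ⟨d.fst, d.snd, h1, h2, P.edges_takeUntil_subset_edges hy ?_⟩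
    rw [← List.mem_reverse, ← Walk.edges_reverse]
    exact List.mem_map_of_mem hd
  · obtain ⟨d, hd, h1, h2⟩ := (P.dropUntil y hy).exists_boundary_dart S hyS hv
    exact ⟨d.fst, d.snd, h1, h2, P.edges_dropUntil_subset_edges hy (List.mem_map_of_mem hd)⟩

lemma walk_mono {V : Type*} {E : SimpleGraph V} (col : V → Bool)
    (hE : ∀ x y, E.Adj x y → col x = col y) {u v : V} (P : E.Walk u v) : col u = col v := by
  induction P with
  | nil => rfl
  | cons h p ih => exact (hE _ _ h).trans ih

lemma walk_even {V : Type*} {F : SimpleGraph V} (col : V → Bool)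
    (hF : ∀ x y, F.Adj x y → col x ≠ col y) {u v : V} (P : F.Walk u v) (h : col u = col v) :
    Even P.length := by
  have := (Coloring.mk col (fun {x y} h => hF x y h)).even_length_iff_congr P
  rw [this]
  change col u = true ↔ col v = true
  rw [h]

/-- Pairs `a < b`. -/
abbrev PairIdx (t : ℕ) := {p : Fin t × Fin t // p.1 < p.2}

/-- the number of tokens is bounded by the cut capacity -/
lemma cut_condition {V U : Type*} [Fintype V] [DecidableEq U] {E F : SimpleGraph V}
    (hdom : ∀ S : Set V, cutSize E S ≤ cutSize F S)
    (I : Immersion E (⊤ : SimpleGraph U)) (t : ℕ) (τ : Fin t → U) (hτ : Function.Injective τ)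
    (K : Finset U) (hK : K.card = t) (hτK : ∀ a, τ a ∉ K)
    (hne : ∀ d : PairIdx t, (⊤ : SimpleGraph U).Adj (τ d.1.1) (τ d.1.2))
    (y : PairIdx t → V) (hy : ∀ d, y d ∈ (I.trail (hne d)).support)
    (c : V → ℕ) (hc : ∀ k ∈ K, c (I.φ k) = t) (S : Set V) :
    tokIn y S ≤ cutSize F S + capIn c S := by
  classical
  refine le_trans ?_ (Nat.add_le_add_right (hdom S) _)
  set A : Finset (Fin t) := Finset.univ.filter fun a => I.φ (τ a) ∈ S with hA
  set B : Finset U := K.filter fun k => I.φ k ∉ S with hB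
  set B' : Finset U := K.filter fun k => I.φ k ∈ S with hB'
  set X : Finset (PairIdx t) := Finset.univ.filter fun d => y d ∈ S ∧
    ¬ (I.φ (τ d.1.1) ∈ S ∧ I.φ (τ d.1.2) ∈ S) with hX
  have hBB : B'.card + B.card = t := by
    rw [← hK, hB, hB']; exact Finset.card_filter_add_card_filter_not _
  have hAt : A.card ≤ t := by simpa using Finset.card_le_univ A
  have h1 : tokIn y S ≤ X.card + A.card * A.card := by
    unfold tokIn
    rw [Finset.sum_boole, Nat.cast_id]
    have hsub : (Finset.univ.filter fun d => y d ∈ S) ⊆ X ∪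
        (Finset.univ.filter fun d : PairIdx t => I.φ (τ d.1.1) ∈ S ∧ I.φ (τ d.1.2) ∈ S) := by
      intro d hd
      simp only [hX, Finset.mem_filter, Finset.mem_univ, true_and, Finset.mem_union] at hd ⊢
      tauto
    refine (Finset.card_le_card hsub).trans ((Finset.card_union_le _ _).trans ?_)
    refine Nat.add_le_add_left ?_ _
    rw [← Finset.card_product]
    refine Finset.card_le_card_of_injOn (fun d => d.1) ?_ ?_
    · intro d hd
      simp only [Finset.coe_filter, Finset.mem_univ, true_and, Set.mem_ofPred_eq] at hd
      simp only [Finset.coe_product, Set.mem_prod, Finset.mem_coe, hA, Finset.mem_filter,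
        Finset.mem_univ, true_and]
      exact hd
    · intro d _ d' _ h
      exact Subtype.ext h
  have h2 : t * B'.card ≤ capIn c S := by
    unfold capIn
    have : t * B'.card = ∑ v ∈ B'.image I.φ, if v ∈ S then c v else 0 := by
      rw [Finset.sum_image (fun a _ b _ h => I.φ.injective h)]
      rw [Finset.sum_congr rfl (g := fun _ => t)]
      · simp [mul_comm]
      · intro k hk
        rw [hB', Finset.mem_filter] at hk
        rw [if_pos hk.2, hc k hk.1]
    rw [this]
    exact Finset.sum_le_sum_of_subset (Finset.subset_univ _)
  have h3 : X.card + A.card * B.card ≤ cutSize E S := by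
    let f1 : PairIdx t → Sym2 U := fun d => s(τ d.1.1, τ d.1.2)
    let f2 : Fin t × U → Sym2 U := fun q => s(τ q.1, q.2)
    have c1 : (X.image f1).card = X.card := by
      apply Finset.card_image_of_injective
      rintro ⟨⟨a, b⟩, hab⟩ ⟨⟨a', b'⟩, hab'⟩ h
      simp only [f1, Sym2.eq_iff] at h
      simp only at hab hab'
      rcases h with ⟨h, h'⟩ | ⟨h, h'⟩
      · simp [hτ h, hτ h']
      · rw [hτ h, hτ h'] at hab; exact absurd hab (lt_asymm hab')
    have c2 : ((A ×ˢ B).image f2).card = A.card * B.card := by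
      rw [Finset.card_image_of_injOn, Finset.card_product]
      rintro ⟨a, k⟩ h ⟨a', k'⟩ h' hh
      simp only [Finset.coe_product, Set.mem_prod, Finset.mem_coe, hB, Finset.mem_filter] at h h'
      simp only [f2, Sym2.eq_iff] at hh
      rcases hh with ⟨hh, hh'⟩ | ⟨hh, hh'⟩
      · simp [hτ hh, hh']
      · exact absurd (hh ▸ h'.2.1) (hτK a)
    have c3 : Disjoint (X.image f1) ((A ×ˢ B).image f2) := by
      rw [Finset.disjoint_left]
      intro p hp hp'
      obtain ⟨d, -, rfl⟩ := Finset.mem_image.1 hp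
      obtain ⟨⟨a, k⟩, h, hh⟩ := Finset.mem_image.1 hp'
      have hk : k ∈ K := (Finset.mem_filter.1 (Finset.mem_product.1 h).2).1
      simp only [f1, f2, Sym2.eq_iff] at hh
      rcases hh with ⟨_, hh'⟩ | ⟨_, hh'⟩
      · exact hτK _ (hh' ▸ hk)
      · exact hτK _ (hh' ▸ hk)
    rw [← c1, ← c2, ← Finset.card_union_of_disjoint c3]
    apply cut_lower I S
    intro p hp
    rcases Finset.mem_union.1 hp with hp | hp
    · obtain ⟨d, hd, rfl⟩ := Finset.mem_image.1 hp
      rw [hX, Finset.mem_filter] at hd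
      exact ⟨_, _, hne d, rfl, walk_cross _ S (hy d) hd.2.1 hd.2.2⟩
    · obtain ⟨⟨a, k⟩, h, rfl⟩ := Finset.mem_image.1 hp
      simp only [Finset.mem_product, hA, hB, Finset.mem_filter, Finset.mem_univ, true_and] at h
      have hak : (⊤ : SimpleGraph U).Adj (τ a) k := by
        rw [top_adj]; rintro rfl; exact hτK a h.2.1
      exact ⟨_, _, hak, rfl, walk_cross _ S (Walk.start_mem_support _) h.1 (fun hh => h.2.2 hh.2)⟩
  have h4 : A.card * A.card ≤ A.card * B.card + t * B'.card := by
    calc A.card * A.card ≤ A.card * t := Nat.mul_le_mul_left _ hAt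
      _ = A.card * B.card + A.card * B'.card := by rw [← mul_add, add_comm, hBB]
      _ ≤ _ := Nat.add_le_add_left (Nat.mul_le_mul_right _ hAt) _
  omega

lemma build_odd_immersion {V : Type*} {G : SimpleGraph V} (t : ℕ) (φ : Fin t ↪ V)
    (w : ∀ d : PairIdx t, G.Walk (φ d.1.1) (φ d.1.2)) (hw : ∀ d, (w d).IsTrail)
    (hodd : ∀ d, Odd (w d).length)
    (hdis : ∀ d f, d ≠ f → List.Disjoint (w d).edges (w f).edges) :
    HasTotallyOddImmersion G (⊤ : SimpleGraph (Fin t)) := by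
  classical
  have hlt : ∀ {u v : Fin t}, (⊤ : SimpleGraph (Fin t)).Adj u v → ¬ u < v → v < u := by
    intro u v h h'
    rw [top_adj] at h
    exact lt_of_le_of_ne (not_lt.1 h') h.symm
  let T : ∀ ⦃u v : Fin t⦄, (⊤ : SimpleGraph (Fin t)).Adj u v → G.Walk (φ u) (φ v) :=
    fun u v h => if huv : u < v then w ⟨(u, v), huv⟩ else (w ⟨(v, u), hlt h huv⟩).reverse
  have hT : ∀ ⦃u v : Fin t⦄ (h : (⊤ : SimpleGraph (Fin t)).Adj u v), ∃ d : PairIdx t,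
      s(d.1.1, d.1.2) = s(u, v) ∧ (T h).length = (w d).length ∧
      ((T h).edges = (w d).edges ∨ (T h).edges = (w d).edges.reverse) := by
    intro u v h
    by_cases huv : u < v
    · refine ⟨⟨(u, v), huv⟩, rfl, ?_, Or.inl ?_⟩ <;> simp [T, huv]
    · refine ⟨⟨(v, u), hlt h huv⟩, Sym2.eq_swap, ?_, Or.inr ?_⟩ <;> simp [T, huv]
  refine ⟨⟨φ, T, ?_, ?_, ?_⟩, ?_⟩
  · intro u v h
    obtain ⟨d, -, -, h1⟩ := hT h
    rw [Walk.isTrail_def]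
    rcases h1 with h1 | h1 <;> rw [h1]
    · exact (hw d).edges_nodup
    · exact List.nodup_reverse.2 (hw d).edges_nodup
  · intro u v h
    by_cases huv : u < v
    · have : ¬ v < u := lt_asymm huv
      simp [T, huv, this]
    · have := hlt h huv
      simp [T, huv, this]
  · intro u v a b h h' hne
    obtain ⟨d, hd, -, h1⟩ := hT h
    obtain ⟨f, hf, -, h2⟩ := hT h'
    have hdf : d ≠ f := by
      rintro rfl
      exact hne (hd.symm.trans hf)
    intro e he he'
    refine hdis d f hdf (a := e) ?_ ?_
    · rcases h1 with h1 | h1 <;> rw [h1] at he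
      · exact he
      · exact List.mem_reverse.1 he
    · rcases h2 with h1 | h1 <;> rw [h1] at he'
      · exact he'
      · exact List.mem_reverse.1 he'
  · intro u v h
    obtain ⟨d, -, h1, -⟩ := hT h
    change Odd (T h).length
    rw [h1]; exact hodd d

/-- `e` is an edge of the branch trail of the pair `p`. -/
def OnTrail {V U : Type*} {E : SimpleGraph V} (I : Immersion E (⊤ : SimpleGraph U))
    (p : Sym2 U) (e : Sym2 V) : Prop :=
  ∃ (i j : U) (h : (⊤ : SimpleGraph U).Adj i j), s(i, j) = p ∧ e ∈ (I.trail h).edges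

lemma OnTrail.unique {V U : Type*} {E : SimpleGraph V} {I : Immersion E (⊤ : SimpleGraph U)}
    {p q : Sym2 U} {e : Sym2 V} (h : OnTrail I p e) (h' : OnTrail I q e) : p = q := by
  obtain ⟨i, j, h1, rfl, h2⟩ := h
  obtain ⟨i', j', h1', rfl, h2'⟩ := h'
  exact immersion_edge_unique I _ _ h2 h2'

lemma OnTrail.mem {V U : Type*} {E : SimpleGraph V} {I : Immersion E (⊤ : SimpleGraph U)}
    {p : Sym2 U} {e : Sym2 V} (h : OnTrail I p e) : e ∈ E.edgeSet := by
  obtain ⟨i, j, h1, rfl, h2⟩ := h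
  exact Walk.edges_subset_edgeSet _ h2

/-- Concatenation of the pieces of a branch trail. -/
lemma concat_walk {V U : Type*} {E F G : SimpleGraph V} (hEG : E ≤ G) (hFG : F ≤ G)
    (hEF : ∀ e ∈ E.edgeSet, e ∉ F.edgeSet)
    (I : Immersion E (⊤ : SimpleGraph U)) (a b k m l m' : U) (y z : V)
    (hadj : E.Adj (I.φ a) y) (hon : OnTrail I s(a, b) s(I.φ a, y))
    (w : F.Walk y z) (hw : w.IsTrail) (hz : I.φ k = z) (hweven : Even w.length)
    (hkm : (⊤ : SimpleGraph U).Adj k m) (hml : (⊤ : SimpleGraph U).Adj m l)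
    (hlm' : (⊤ : SimpleGraph U).Adj l m') (hm'b : (⊤ : SimpleGraph U).Adj m' b)
    (p1 : Odd (I.trail hkm).length ↔ Odd (I.trail hml).length)
    (p2 : Odd (I.trail hlm').length ↔ Odd (I.trail hm'b).length)
    (hnd : [s(a, b), s(k, m), s(m, l), s(l, m'), s(m', b)].Nodup) :
    ∃ W : G.Walk (I.φ a) (I.φ b), W.IsTrail ∧ Odd W.length ∧
      ∀ e ∈ W.edges, e ∈ w.edges ∨
        ∃ p ∈ [s(a, b), s(k, m), s(m, l), s(l, m'), s(m', b)], OnTrail I p e := by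
  subst hz
  have on : ∀ {i j : U} (h : (⊤ : SimpleGraph U).Adj i j) {e}, e ∈ (I.trail h).edges →
      OnTrail I s(i, j) e := by
    intro i j h e he
    exact ⟨_, _, h, rfl, he⟩
  have hF : ∀ {e}, e ∈ w.edges → e ∈ F.edgeSet := by
    intro e he
    exact Walk.edges_subset_edgeSet _ he
  let W : G.Walk (I.φ a) (I.φ b) :=
    (Walk.cons (hEG hadj) (w.mapLe hFG)).append
      (((I.trail hkm).mapLe hEG).append (((I.trail hml).mapLe hEG).append
        (((I.trail hlm').mapLe hEG).append ((I.trail hm'b).mapLe hEG))))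
  simp only [List.nodup_cons, List.mem_cons, List.not_mem_nil, or_false, not_or, List.nodup_nil,
    and_true, not_false_eq_true] at hnd
  obtain ⟨⟨n1, n2, n3, n4⟩, ⟨n5, n6, n7⟩, ⟨n8, n9⟩, n10⟩ := hnd
  refine ⟨W, ?_, ?_, ?_⟩
  · have hne : ∀ {p q : Sym2 U} {e}, p ≠ q → OnTrail I p e → OnTrail I q e → False := by
      intro p q e h h1 h2
      exact h (h1.unique h2)
    have hwE : ∀ {p : Sym2 U} {e}, e ∈ w.edges → OnTrail I p e → False := by
      intro p e h1 h2
      exact hEF _ h2.mem (hF h1)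
    simp only [W, Walk.isTrail_append, Walk.isTrail_cons, Walk.edges_append,
      Walk.edges_mapLe_eq_edges, Walk.edges_cons, List.disjoint_append_right]
    have hd : ∀ {i j i' j' : U} (h : (⊤ : SimpleGraph U).Adj i j)
        (h' : (⊤ : SimpleGraph U).Adj i' j'), s(i, j) ≠ s(i', j') →
        List.Disjoint (I.trail h).edges (I.trail h').edges :=
      fun h h' hn => I.disjoint h h' hn
    have hd0 : ∀ {i j : U} (h : (⊤ : SimpleGraph U).Adj i j), s(a, b) ≠ s(i, j) →
        List.Disjoint (s(I.φ a, y) :: w.edges) (I.trail h).edges := by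
      intro i j h hn e he he'
      rcases List.mem_cons.1 he with rfl | he
      · exact hne hn hon (on h he')
      · exact hwE he (on h he')
    have it : ∀ {i j : U} (h : (⊤ : SimpleGraph U).Adj i j), ((I.trail h).mapLe hEG).IsTrail := by
      intro i j h
      exact (I.isTrail h).mapLe hEG
    refine ⟨⟨hw.mapLe hFG, fun h => hwE h hon⟩, ⟨it _, ⟨it _, ⟨it _, it _,
      hd _ _ n10⟩, hd _ _ n8, hd _ _ n9⟩, hd _ _ n5, hd _ _ n6, hd _ _ n7⟩,
      hd0 _ n1, hd0 _ n2, hd0 _ n3, hd0 _ n4⟩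
  · simp only [W, Walk.length_append, Walk.length_cons, Walk.length_mapLe]
    simp only [Nat.odd_iff, Nat.even_iff] at *
    omega
  · intro e he
    simp only [W, Walk.edges_append, Walk.edges_mapLe_eq_edges, Walk.edges_cons,
      List.mem_append, List.mem_cons] at he
    simp only [List.mem_cons, List.not_mem_nil, or_false, exists_eq_or_imp, exists_eq_left]
    rcases he with (rfl | he) | he | he | he | he
    · exact Or.inr (Or.inl hon)
    · exact Or.inl he
    · exact Or.inr (Or.inr (Or.inl (on _ he)))
    · exact Or.inr (Or.inr (Or.inr (Or.inl (on _ he))))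
    · exact Or.inr (Or.inr (Or.inr (Or.inr (Or.inl (on _ he)))))
    · exact Or.inr (Or.inr (Or.inr (Or.inr (Or.inr (on _ he)))))

lemma tokIn_eq_card {V I : Type*} [Fintype I] (y : I → V) (S : Set V)
    [DecidablePred fun i => y i ∈ S] :
    tokIn y S = (Finset.univ.filter fun i => y i ∈ S).card := by
  unfold tokIn
  rw [Finset.card_filter]
  refine Finset.sum_congr rfl fun i _ => ?_
  split_ifs <;> rfl

lemma tuple_nodup {U : Type*} {T K L M : Finset U}
    (hTK : ∀ ⦃x⦄, x ∈ T → x ∉ K) (hTL : ∀ ⦃x⦄, x ∈ T → x ∉ L) (hTM : ∀ ⦃x⦄, x ∈ T → x ∉ M)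
    (hKL : ∀ ⦃x⦄, x ∈ K → x ∉ L) (hKM : ∀ ⦃x⦄, x ∈ K → x ∉ M) (hLM : ∀ ⦃x⦄, x ∈ L → x ∉ M)
    {a b k m l m' : U} (ha : a ∈ T) (hb : b ∈ T) (hk : k ∈ K) (hm : m ∈ M) (hl : l ∈ L)
    (hm' : m' ∈ M) (hmm : m ≠ m') :
    [s(a, b), s(k, m), s(m, l), s(l, m'), s(m', b)].Nodup := by
  simp only [List.nodup_cons, List.mem_cons, List.not_mem_nil, or_false, not_or,
    List.nodup_nil, and_true, not_false_eq_true]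
  refine ⟨⟨?_, ?_, ?_, ?_⟩, ⟨?_, ?_, ?_⟩, ⟨?_, ?_⟩, ?_⟩ <;> intro h <;>
    rw [Sym2.eq_iff] at h <;> rcases h with ⟨h1, h2⟩ | ⟨h1, h2⟩ <;>
    first
    | exact hmm h1
    | exact hmm h2
    | exact hmm h1.symm
    | exact hmm h2.symm
    | (subst h1; solve_by_elim)
    | (subst h2; solve_by_elim)
    | (subst h1; subst h2; solve_by_elim)

lemma tuple_disjoint {U : Type*} {T K L M : Finset U}
    (hTK : ∀ ⦃x⦄, x ∈ T → x ∉ K) (hTL : ∀ ⦃x⦄, x ∈ T → x ∉ L) (hTM : ∀ ⦃x⦄, x ∈ T → x ∉ M)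
    (hKL : ∀ ⦃x⦄, x ∈ K → x ∉ L) (hKM : ∀ ⦃x⦄, x ∈ K → x ∉ M) (hLM : ∀ ⦃x⦄, x ∈ L → x ∉ M)
    {a b k m l m' : U} (ha : a ∈ T) (hb : b ∈ T) (hk : k ∈ K) (hm : m ∈ M) (hl : l ∈ L)
    (hm' : m' ∈ M) {a₂ b₂ k₂ m₂ l₂ n₂ : U} (ha₂ : a₂ ∈ T) (hb₂ : b₂ ∈ T) (hk₂ : k₂ ∈ K)
    (hm₂ : m₂ ∈ M) (hl₂ : l₂ ∈ L) (hn₂ : n₂ ∈ M) (hp : s(a, b) ≠ s(a₂, b₂))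
    (q1 : k = k₂ → m ≠ m₂) (q2 : b = b₂ → m' ≠ n₂)
    (q3 : l = l₂ → m ≠ m₂ ∧ m ≠ n₂ ∧ m' ≠ m₂ ∧ m' ≠ n₂) :
    ∀ p ∈ [s(a, b), s(k, m), s(m, l), s(l, m'), s(m', b)],
      p ∉ [s(a₂, b₂), s(k₂, m₂), s(m₂, l₂), s(l₂, n₂), s(n₂, b₂)] := by
  intro p hp1 hp2
  simp only [List.mem_cons, List.not_mem_nil, or_false] at hp1 hp2
  rcases hp1 with rfl | rfl | rfl | rfl | rfl <;> rcases hp2 with h | h | h | h | h <;>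
    first
    | exact hp h
    | (clear hp
       rw [Sym2.eq_iff] at h
       rcases h with ⟨h1, h2⟩ | ⟨h1, h2⟩ <;> subst h1 <;> subst h2 <;>
       first
       | solve_by_elim
       | exact q1 rfl rfl
       | exact q2 rfl rfl
       | (obtain ⟨c1, c2, c3, c4⟩ := q3 rfl
          first
          | exact c1 rfl
          | exact c2 rfl
          | exact c3 rfl
          | exact c4 rfl))

theorem core_odd {V U : Type*} [Fintype V] [Fintype U] [DecidableEq U] (G : SimpleGraph V)
    (t : ℕ) (ht : 1 ≤ t) (hU : 60 * t ≤ Fintype.card U) (col : V → Bool)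
    (hdom : ∀ S : Set V, cutSize (G.deleteEdges (biG G col).edgeSet) S ≤ cutSize (biG G col) S)
    (I : Immersion (G.deleteEdges (biG G col).edgeSet) (⊤ : SimpleGraph U)) :
    HasTotallyOddImmersion G (⊤ : SimpleGraph (Fin t)) := by
  classical
  set F := biG G col with hF
  set E := G.deleteEdges F.edgeSet with hE
  have hEG : E ≤ G := deleteEdges_le _
  have hFG : F ≤ G := inf_le_left
  have hEF : ∀ e ∈ E.edgeSet, e ∉ F.edgeSet := by
    intro e he
    rw [hE, edgeSet_deleteEdges] at he
    exact he.2
  have hEcol : ∀ x y, E.Adj x y → col x = col y := fun x y h => ((mono_adj G col x y).1 h).2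
  have hFcol : ∀ x y, F.Adj x y → col x ≠ col y := fun x y h => ((biG_adj G col x y).1 h).2
  have hUcol : ∀ i j : U, col (I.φ i) = col (I.φ j) := by
    intro i j
    by_cases h : i = j
    · rw [h]
    · exact walk_mono col hEcol (I.trail ((top_adj i j).2 h))
  let χ : U → U → Bool := fun i j =>
    if h : (⊤ : SimpleGraph U).Adj i j then decide (Odd (I.trail h).length) else false
  have hχ : ∀ {i j : U} (h : (⊤ : SimpleGraph U).Adj i j),
      χ i j = decide (Odd (I.trail h).length) := fun {i j} h => by simp only [χ, dif_pos h]
  have hχs : ∀ {i j : U} (h : (⊤ : SimpleGraph U).Adj i j),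
      (Odd (I.trail h.symm).length ↔ Odd (I.trail h).length) := fun h => by
    rw [I.symm h, Walk.length_reverse]
  obtain ⟨T, K, L, M, hT, hK, hTK, hTL, hTM, hKL, hKM, hLM, hsel⟩ := select_classes t hU χ
  rw [Finset.disjoint_left] at hTK hTL hTM hKL hKM hLM
  obtain ⟨τ, hτ, hτT⟩ : ∃ τ : Fin t → U, Function.Injective τ ∧ ∀ a, τ a ∈ T :=
    ⟨fun a => ((T.equivFinOfCardEq hT).symm a : U),
      fun a b h => (T.equivFinOfCardEq hT).symm.injective (Subtype.ext h),
      fun a => ((T.equivFinOfCardEq hT).symm a).2⟩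
  have hne : ∀ d : PairIdx t, (⊤ : SimpleGraph U).Adj (τ d.1.1) (τ d.1.2) := fun d => by
    rw [top_adj]; exact fun h => d.2.ne (hτ h)
  have hnil : ∀ d : PairIdx t, ¬ (I.trail (hne d)).Nil := fun d =>
    Walk.not_nil_of_ne (fun h => d.2.ne (hτ (I.φ.injective h)))
  let y : PairIdx t → V := fun d => (I.trail (hne d)).snd
  have hyadj : ∀ d, E.Adj (I.φ (τ d.1.1)) (y d) := fun d => Walk.adj_snd (hnil d)
  have hyedge : ∀ d, s(I.φ (τ d.1.1), y d) ∈ (I.trail (hne d)).edges := fun d =>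
    Walk.mk_start_snd_mem_edges (hnil d)
  have hysup : ∀ d, y d ∈ (I.trail (hne d)).support := fun d =>
    Walk.snd_mem_support_of_mem_edges _ (hyedge d)
  let c : V → ℕ := fun v => if ∃ k ∈ K, I.φ k = v then t else 0
  obtain ⟨κ₀, w, hw1, hw2, hw3⟩ := menger c _ F y rfl
    (cut_condition hdom I t τ hτ K hK (fun a => hTK (hτT a)) hne y hysup c
      (fun k hk => if_pos ⟨k, hk, rfl⟩))
  have hκ₀ : ∀ d, ∃ k ∈ K, I.φ k = κ₀ d := by
    intro d
    by_contra hno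
    have h1 := hw3 (κ₀ d)
    simp only [c, if_neg hno] at h1
    unfold tokIn at h1
    have h2 := Finset.single_le_sum (f := fun i => if κ₀ i ∈ ({κ₀ d} : Set V) then 1 else 0)
      (fun _ _ => Nat.zero_le _) (Finset.mem_univ d)
    simp only [Set.mem_singleton_iff, if_true] at h1 h2
    omega
  choose κ hκK hκ using hκ₀
  have hκc : ∀ k, (Finset.univ.filter fun d => κ d = k).card ≤ t := by
    intro k
    have h1 := hw3 (I.φ k)
    have h2 : c (I.φ k) ≤ t := by simp only [c]; split_ifs <;> omega
    refine le_trans ?_ (h1.trans h2)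
    rw [tokIn_eq_card]
    apply Finset.card_le_card
    intro d hd
    simp only [Finset.mem_filter, Finset.mem_univ, true_and, Set.mem_singleton_iff] at hd ⊢
    rw [← hκ, hd]
  have hβc : ∀ k, (Finset.univ.filter fun d : PairIdx t => τ d.1.2 = k).card ≤ t := by
    intro k
    have : (Finset.univ.filter fun d : PairIdx t => τ d.1.2 = k).card ≤
        (Finset.univ : Finset (Fin t)).card := by
      refine Finset.card_le_card_of_injOn (fun d => d.1.1) (fun _ _ => Finset.mem_univ _) ?_
      intro d hd d' hd' h
      simp only [Finset.coe_filter, Finset.mem_univ, true_and, Set.mem_ofPred_eq] at hd hd'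
      exact Subtype.ext (Prod.ext h (hτ (hd.trans hd'.symm)))
    simpa using this
  have hDc : Fintype.card (PairIdx t) ≤ t * t := by
    have := Fintype.card_subtype_le (fun p : Fin t × Fin t => p.1 < p.2)
    simpa using this
  obtain ⟨m, l, m', hr1, hr2⟩ := greedy_route κ (fun d => τ d.1.2) t ht hκc hβc hDc M L χ
    (fun d => hsel _ (hκK d) _ (hτT _))
  let J : PairIdx t → List (Sym2 U) := fun d =>
    [s(τ d.1.1, τ d.1.2), s(κ d, m d), s(m d, l d), s(l d, m' d), s(m' d, τ d.1.2)]
  have hwalk : ∀ d : PairIdx t, ∃ W : G.Walk (I.φ (τ d.1.1)) (I.φ (τ d.1.2)), W.IsTrail ∧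
      Odd W.length ∧ ∀ e ∈ W.edges, e ∈ (w d).edges ∨ ∃ p ∈ J d, OnTrail I p e := by
    intro d
    obtain ⟨r1, r2, r3, r4, r5, r6⟩ := hr1 d
    have a1 : (⊤ : SimpleGraph U).Adj (κ d) (m d) := by
      rw [top_adj]; intro h; exact hKM (hκK d) (h ▸ r1)
    have a2 : (⊤ : SimpleGraph U).Adj (l d) (m d) := by
      rw [top_adj]; intro h; exact hLM r2 (h ▸ r1)
    have a3 : (⊤ : SimpleGraph U).Adj (l d) (m' d) := by
      rw [top_adj]; intro h; exact hLM r2 (h ▸ r3)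
    have a4 : (⊤ : SimpleGraph U).Adj (τ d.1.2) (m' d) := by
      rw [top_adj]; intro h; exact hTM (hτT _) (h ▸ r3)
    rw [hχ a1, hχ a2, decide_eq_decide] at r4
    rw [hχ a3, hχ a4, decide_eq_decide] at r5
    refine concat_walk hEG hFG hEF I _ _ (κ d) (m d) (l d) (m' d) (y d) (κ₀ d) (hyadj d)
      ⟨_, _, hne d, rfl, hyedge d⟩ (w d) (hw1 d) (hκ d) ?_ a1 a2.symm a3 a4.symm
      (r4.trans (hχs a2).symm) (r5.trans (hχs a4).symm) ?_
    · apply walk_even col hFcol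
      rw [← hκ d, ← hEcol _ _ (hyadj d)]
      exact hUcol _ _
    · exact tuple_nodup hTK hTL hTM hKL hKM hLM (hτT _) (hτT _) (hκK d) r1 r2 r3 r6
  choose W hW1 hW2 hW3 using hwalk
  refine build_odd_immersion t ⟨fun a => I.φ (τ a), fun a b h => hτ (I.φ.injective h)⟩ W hW1 hW2 ?_
  intro d f hdf e hd hf
  have hJ : ∀ p ∈ J d, p ∉ J f := by
    obtain ⟨r1, r2, r3, -, -, r6⟩ := hr1 d
    obtain ⟨s1, s2, s3, -, -, s6⟩ := hr1 f
    obtain ⟨q1, q2, q3⟩ := hr2 d f hdf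
    have hp : s(τ d.1.1, τ d.1.2) ≠ s(τ f.1.1, τ f.1.2) := by
      intro h
      rw [Sym2.eq_iff] at h
      rcases h with ⟨h, h'⟩ | ⟨h, h'⟩
      · exact hdf (Subtype.ext (Prod.ext (hτ h) (hτ h')))
      · have h1 := d.2
        rw [hτ h, hτ h'] at h1
        exact lt_asymm h1 f.2
    exact tuple_disjoint hTK hTL hTM hKL hKM hLM (hτT _) (hτT _) (hκK d) r1 r2 r3
      (hτT _) (hτT _) (hκK f) s1 s2 s3 hp q1 q2 q3
  rcases hW3 d e hd with h1 | ⟨p, hp, h1⟩ <;> rcases hW3 f e hf with h2 | ⟨q, hq, h2⟩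
  · exact hw2 d f hdf h1 h2
  · exact hEF _ h2.mem (Walk.edges_subset_edgeSet _ h1)
  · exact hEF _ h1.mem (Walk.edges_subset_edgeSet _ h2)
  · have := h1.unique h2
    subst this
    exact hJ p hp hq

/-- For every integer t ≥ 1, every finite simple graph G with no totally odd
immersion of K_t has a set of edges F ⊆ E(G) such that G[F] is bipartite and G ∖ F does
not admit an immersion of K_{98000·t + 4410071}. -/
theorem totally_odd_immersion_free_decomposition {V : Type*} [Fintype V] (t : ℕ) (ht : 1 ≤ t)
    (G : SimpleGraph V) (h : ¬ HasTotallyOddImmersion G (⊤ : SimpleGraph (Fin t))) :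
    ∃ F ⊆ G.edgeSet, (SimpleGraph.fromEdgeSet F).Colorable 2 ∧
      ¬ HasImmersion (G.deleteEdges F) (⊤ : SimpleGraph (Fin (98000 * t + 4410071))) := by
  obtain ⟨col, hcol⟩ := exists_max_cut G
  refine ⟨(biG G col).edgeSet, edgeSet_mono inf_le_left, ?_, ?_⟩
  · rw [fromEdgeSet_edgeSet]
    have C : (biG G col).Coloring Bool :=
      Coloring.mk col (fun {x y} h => ((biG_adj G col x y).1 h).2)
    simpa using C.colorable
  · rintro ⟨I⟩
    exact h (core_odd G t ht (by rw [Fintype.card_fin]; omega) col hcol I)
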